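/- (Maximum principle for the Landau coefficients) Let γ ∈ [-3,-2] and T > 0. Let (g_t)_{t∈[0,T]} be non-negative measurable functions on ℝ³ with ∫ g_t = 1 for every t, sup_{t∈[0,T]} ‖g_t‖_{L^∞(ℝ³)} < ∞ and sup_{t∈[0,T]} ∫ ⟨v⟩^p g_t < ∞ where p = γ(γ+2)/(γ+5) − γ, and let ā, c̄ be the associated Landau coefficients. Let u ∈ C([0,T]×ℝ³) be C¹ in time on (0,T] and C² in velocity, a subsolution: ∂_t u ≤ ā : ∇²u + c̄ u on (0,T]×ℝ³, with u(0,v) ≤ 0 for all v ∈ ℝ³, and satisfying the growth condition u(t,v) ≤ K e^{η|v|²} on [0,T]×ℝ³ for some K, η > 0. Then u(t,v) ≤ 0 for all (t,v) ∈ [0,T]×ℝ³. -/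

import Mathlib

noncomputable section

open MeasureTheory Real
open scoped ENNReal RealInnerProductSpace

/-- The velocity space ℝ³. -/
abbrev V3 : Type := EuclideanSpace ℝ (Fin 3)

/-- 3×3 real matrices. -/
abbrev Mat3 : Type := Matrix (Fin 3) (Fin 3) ℝ

/-- Japanese bracket ⟨v⟩ = √(1+|v|²). -/
def jap (v : V3) : ℝ := Real.sqrt (1 + ‖v‖ ^ 2)

/-- `i`-th basis vector of ℝ³. -/
def esingle (i : Fin 3) : V3 := EuclideanSpace.single i (1 : ℝ)

/-- Orthogonal projection Π(z) onto z^⊥. -/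
def proj (z : V3) : Mat3 := fun i j =>
  (if i = j then (1 : ℝ) else 0) - (z i / ‖z‖) * (z j / ‖z‖)

/-- Landau kernel a(z) = |z|^{γ+2} Π(z). -/
def landauKernel (γ : ℝ) (z : V3) : Mat3 := fun i j => ‖z‖ ^ (γ + 2) * proj z i j

/-- Cut-off kernel ã(z) = ⟨z⟩^γ |z|² Π(z). -/
def cutoffKernel (γ : ℝ) (z : V3) : Mat3 := fun i j => jap z ^ γ * ‖z‖ ^ 2 * proj z i j

/-- Bilinear form ⟨A w, z⟩. -/
def bilin (A : Mat3) (w z : V3) : ℝ := ∑ i, ∑ j, A i j * w i * z j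

/-- Quadratic form A : w^{⊗2}. -/
def quadForm (A : Mat3) (w : V3) : ℝ := bilin A w w

/-- Matrix dot product A : B. -/
def matDot (A B : Mat3) : ℝ := ∑ i, ∑ j, A i j * B i j

/-- (Frobenius) norm of a 3×3 matrix. -/
def matNorm (A : Mat3) : ℝ := Real.sqrt (∑ i, ∑ j, (A i j) ^ 2)

/-- Entropy H(f) = ∫ f ln f. -/
def entropy (f : V3 → ℝ) : ℝ := ∫ v, f v * Real.log (f v)

/-- Relative entropy H(f|g) = ∫ ((f/g) ln(f/g) − f/g + 1) g ∈ [0,∞]. -/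
def relEntropy (f g : V3 → ℝ) : ℝ≥0∞ :=
  ∫⁻ v, ENNReal.ofReal ((f v / g v * Real.log (f v / g v) - f v / g v + 1) * g v)

/-- Hessian matrix of a function on ℝ³. -/
def hess (φ : V3 → ℝ) (v : V3) : Mat3 := fun i j =>
  iteratedFDeriv ℝ 2 φ v ![esingle i, esingle j]

/-- Hessian matrix within a set. -/
def hessW (φ : V3 → ℝ) (s : Set V3) (v : V3) : Mat3 := fun i j =>
  iteratedFDerivWithin ℝ 2 φ s v ![esingle i, esingle j]

/-- Gradient of the logarithm, ∇ ln φ. -/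
def logGrad (φ : V3 → ℝ) (v : V3) : V3 := gradient (fun w => Real.log (φ w)) v

/-- Hessian of the logarithm, ∇² ln φ. -/
def logHess (φ : V3 → ℝ) (v : V3) : Mat3 := hess (fun w => Real.log (φ w)) v

/-- `G` is the weak gradient of `F` on ℝ⁶ ≃ ℝ³ × ℝ³. -/
def IsWeakGrad6 (F : V3 × V3 → ℝ) (G : V3 × V3 → V3 × V3) : Prop :=
  ∀ φ : V3 × V3 → ℝ, ContDiff ℝ (⊤ : ℕ∞) φ → HasCompactSupport φ →
    ∀ e : V3 × V3,
      (∫ p : V3 × V3, F p * fderiv ℝ φ p e) =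
        - ∫ p : V3 × V3, (⟪(G p).1, e.1⟫ + ⟪(G p).2, e.2⟫) * φ p

/-- `G` is the weak gradient of `F` on ℝ³. -/
def IsWeakGrad3 (F : V3 → ℝ) (G : V3 → V3) : Prop :=
  ∀ φ : V3 → ℝ, ContDiff ℝ (⊤ : ℕ∞) φ → HasCompactSupport φ →
    ∀ e : V3, (∫ v, F v * fderiv ℝ φ v e) = - ∫ v, ⟪G v, e⟫ * φ v

/-- Entropy production functional associated with a weak gradient of √(f f'). -/
def dissipation (γ : ℝ) (G : V3 × V3 → V3 × V3) : ℝ≥0∞ :=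
  ∫⁻ p : V3 × V3,
    ENNReal.ofReal (quadForm (landauKernel γ (p.1 - p.2)) ((G p).1 - (G p).2))

/-- Villani's H-solutions of the Landau equation on [0,T], with weak gradient data
`fGrad s` for √(f_s f_s'). -/
structure IsHSolution (γ T : ℝ) (f : ℝ → V3 → ℝ) (fGrad : ℝ → V3 × V3 → V3 × V3) : Prop where
  nonneg : ∀ t ∈ Set.Icc 0 T, ∀ v, 0 ≤ f t v
  integrable : ∀ t ∈ Set.Icc 0 T, Integrable (f t)
  entIntegrable : ∀ t ∈ Set.Icc 0 T, Integrable (fun v => f t v * Real.log (f t v))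
  contDistrib : ∀ φ : V3 → ℝ, ContDiff ℝ (⊤ : ℕ∞) φ → HasCompactSupport φ →
    ContinuousOn (fun t => ∫ v, φ v * f t v) (Set.Icc 0 T)
  mass : ∀ t ∈ Set.Icc 0 T, (∫ v, f t v) = 1
  momentumIntegrable : ∀ t ∈ Set.Icc 0 T, Integrable (fun v => f t v • v)
  momentum : ∀ t ∈ Set.Icc 0 T, (∫ v, f t v • v) = ∫ v, f 0 v • v
  energyIntegrable : ∀ t ∈ Set.Icc 0 T, Integrable (fun v => ‖v‖ ^ 2 * f t v)
  energy : ∀ t ∈ Set.Icc 0 T, (∫ v, ‖v‖ ^ 2 * f t v) = ∫ v, ‖v‖ ^ 2 * f 0 v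
  weakGrad : ∀ᵐ s ∂(volume.restrict (Set.Icc 0 T)),
    IsWeakGrad6 (fun p => Real.sqrt (f s p.1 * f s p.2)) (fGrad s)
  dissipationFinite : ∀ t ∈ Set.Icc 0 T,
    (∫⁻ s in Set.Ioc (0 : ℝ) t, dissipation γ (fGrad s)) < ⊤
  entropyProd : ∀ t ∈ Set.Icc 0 T,
    entropy (f t) + 2 * (∫⁻ s in Set.Ioc (0 : ℝ) t, dissipation γ (fGrad s)).toReal ≤
      entropy (f 0)
  weakForm : ∀ φ : ℝ → V3 → ℝ,
    ContDiff ℝ 2 (fun q : ℝ × V3 => φ q.1 q.2) →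
    HasCompactSupport (fun q : ℝ × V3 => φ q.1 q.2) →
    ∀ t ∈ Set.Icc 0 T,
      (∫ v, φ t v * f t v) - (∫ v, φ 0 v * f 0 v) =
        (∫ s in (0 : ℝ)..t, ∫ v, deriv (fun r => φ r v) s * f s v) -
          ∫ s in (0 : ℝ)..t, ∫ p : V3 × V3,
            bilin (landauKernel γ (p.1 - p.2))
              (gradient (φ s) p.1 - gradient (φ s) p.2)
              ((fGrad s p).1 - (fGrad s p).2) * Real.sqrt (f s p.1 * f s p.2)

/-- Convolved Landau matrix ā = a ⋆ f. -/
def abar (γ : ℝ) (f : V3 → ℝ) (v : V3) : Mat3 := fun i j =>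
  ∫ w, landauKernel γ (v - w) i j * f w

/-- Zero order coefficient c̄ of the Landau equation in nondivergence form. -/
def cbar (γ : ℝ) (f : V3 → ℝ) (v : V3) : ℝ :=
  if γ = -3 then 8 * Real.pi * f v else 2 * (γ + 3) * ∫ w, ‖v - w‖ ^ γ * f w

/-- Convolution of the cut-off kernel with a density. -/
def cutoffConv (γ : ℝ) (f : V3 → ℝ) (v : V3) : Mat3 := fun i j =>
  ∫ w, cutoffKernel γ (v - w) i j * f w

/-- Classical solution of the Landau equation on a time set `I`
(in nondivergence parabolic form ∂_t g = ā : ∇²g + c̄ g). -/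
structure IsClassicalSolution (γ : ℝ) (I : Set ℝ) (g : ℝ → V3 → ℝ) : Prop where
  pos : ∀ t ∈ I, ∀ v, 0 < g t v
  timeC1 : ∀ v, ContDiffOn ℝ 1 (fun t => g t v) I
  velC2 : ∀ t ∈ I, ContDiff ℝ 2 (g t)
  eqn : ∀ t ∈ I, ∀ v,
    derivWithin (fun s => g s v) I t =
      matDot (abar γ (g t) v) (hess (g t) v) + cbar γ (g t) v * g t v

/-- The moment exponent ρ = max(2κ, 2κ+2γ+4, 2ζ, ν). -/
def rhoExp (γ κ ζ ν : ℝ) : ℝ := max (max (2 * κ) (2 * κ + 2 * γ + 4)) (max (2 * ζ) ν)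

/-- Setting (⋆) of the paper. -/
structure Setting (γ T : ℝ) where
  f : ℝ → V3 → ℝ
  fGrad : ℝ → V3 × V3 → V3 × V3
  g : ℝ → V3 → ℝ
  κ : ℝ
  ν : ℝ
  ζ : ℝ
  K1 : ℝ → ℝ
  K2 : ℝ → ℝ
  K3 : ℝ → ℝ
  Mf : ℝ
  Mg : ℝ
  hγ : γ ∈ Set.Ico (-3 : ℝ) 0
  hT : 0 < T
  hf : IsHSolution γ T f fGrad
  hg : IsClassicalSolution γ (Set.Icc 0 T) g
  hκ : 1 ≤ κ
  hν : 1 ≤ ν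
  hζ : 0 ≤ ζ
  K1nonneg : ∀ t, 0 ≤ K1 t
  K2nonneg : ∀ t, 0 ≤ K2 t
  K3nonneg : ∀ t, 0 ≤ K3 t
  K1meas : Measurable K1
  K2meas : Measurable K2
  K3meas : Measurable K3
  K1bound : ∀ t ∈ Set.Icc 0 T, ∀ v, ‖logGrad (g t) v‖ ≤ K1 t * jap v ^ κ
  K2bound : ∀ t ∈ Set.Icc 0 T, ∀ v,
    |derivWithin (fun s => Real.log (g s v)) (Set.Icc 0 T) t| ≤ K2 t * jap v ^ ν
  K3bound : ∀ t ∈ Set.Icc 0 T, ∀ v, matNorm (logHess (g t) v) ≤ K3 t * jap v ^ ζ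
  Kint : IntegrableOn (fun t => K2 t + K1 t ^ 2 + K3 t ^ 2) (Set.Icc 0 T)
  fMomentInt : ∀ t ∈ Set.Icc 0 T,
    Integrable (fun v => jap v ^ (rhoExp γ κ ζ ν - γ) * f t v)
  fMoment : ∀ t ∈ Set.Icc 0 T, (∫ v, jap v ^ (rhoExp γ κ ζ ν - γ) * f t v) ≤ Mf
  gMomentInt : ∀ t ∈ Set.Icc 0 T,
    Integrable (fun v => jap v ^ (rhoExp γ κ ζ ν - γ) * g t v)
  gMoment : ∀ t ∈ Set.Icc 0 T, (∫ v, jap v ^ (rhoExp γ κ ζ ν - γ) * g t v) ≤ Mg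

/-- The good term 𝒢_s. -/
def goodTerm (γ : ℝ) (f g : ℝ → V3 → ℝ) (fGrad : ℝ → V3 × V3 → V3 × V3) (s : ℝ) : ℝ :=
  2 * ∫ p : V3 × V3,
    quadForm (landauKernel γ (p.1 - p.2))
      (((fGrad s p).1 - (fGrad s p).2) -
        Real.sqrt (f s p.1 * f s p.2) • (logGrad (g s) p.1 - logGrad (g s) p.2))

/-- The vector field a(v−v')(∇−∇')(g g'). -/
def landauFlux (γ : ℝ) (g : V3 → ℝ) (v w : V3) : Fin 3 → ℝ := fun i =>
  ∑ j, landauKernel γ (v - w) i j * (g w * (gradient g v) j - g v * (gradient g w) j)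

/-- (∇−∇')·[a(v−v')(∇−∇')(g g')]. -/
def divDiffFlux (γ : ℝ) (g : V3 → ℝ) (v w : V3) : ℝ :=
  ∑ i, (fderiv ℝ (fun z => landauFlux γ g z w i) v (esingle i) -
        fderiv ℝ (fun z => landauFlux γ g v z i) w (esingle i))

/-- The bad term ℬ_s. -/
def badTerm (γ : ℝ) (f g : ℝ → V3 → ℝ) (s : ℝ) : ℝ :=
  (1 / 2) * ∫ p : V3 × V3,
    (f s p.1 - g s p.1) * (f s p.2 - g s p.2) / (g s p.1 * g s p.2) *
      divDiffFlux γ (g s) p.1 p.2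

/-- Weighted relative Fisher information ∫ |2∇√f − √f ∇ln g|² ⟨v⟩^γ dv. -/
def relFisher (γ : ℝ) (f g : V3 → ℝ) (fGrad3 : V3 → V3) : ℝ :=
  ∫ v, ‖(2 : ℝ) • fGrad3 v - Real.sqrt (f v) • logGrad g v‖ ^ 2 * jap v ^ γ

/-- ‖⟨v⟩^{−κ} ∇ ln g_s‖_{L^∞(ℝ³)} ∈ [0,∞]. -/
def gradLogSup (g : ℝ → V3 → ℝ) (κ s : ℝ) : ℝ≥0∞ :=
  ⨆ v : V3, ENNReal.ofReal (jap v ^ (-κ) * ‖logGrad (g s) v‖)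

/-- ‖⟨v⟩^{−ν} ∂_s ln g_s‖_{L^∞(ℝ³)} ∈ [0,∞]. -/
def dtLogSup (g : ℝ → V3 → ℝ) (T ν s : ℝ) : ℝ≥0∞ :=
  ⨆ v : V3, ENNReal.ofReal
    (jap v ^ (-ν) * |derivWithin (fun r => Real.log (g r v)) (Set.Icc 0 T) s|)

/-- ‖⟨v⟩^{−ζ} ∇² ln g_s‖_{L^∞(ℝ³)} ∈ [0,∞]. -/
def hessLogSup (g : ℝ → V3 → ℝ) (ζ s : ℝ) : ℝ≥0∞ :=
  ⨆ v : V3, ENNReal.ofReal (jap v ^ (-ζ) * matNorm (logHess (g s) v))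

/-- Open cube Σ_R(v₀) = v₀ + (−R,R)³. -/
def cube (v₀ : V3) (R : ℝ) : Set V3 := {v | ∀ i, |v i - v₀ i| < R}

/-- Closed cube v₀ + [−R,R]³ centered at the origin. -/
def ccube (R : ℝ) : Set V3 := {v | ∀ i, |v i| ≤ R}

/-- Distance to the boundary of the cube Σ_R(v₀). -/
def dCube (v₀ : V3) (R : ℝ) (v : V3) : ℝ :=
  Finset.univ.inf' (Finset.univ_nonempty) fun i : Fin 3 => R - |v i - v₀ i|

/-- The moment exponent k(γ,ℓ,δ) of Theorem 2. -/
def kExp (γ ℓ δ : ℝ) : ℝ := 8 * (max (2 + (ℓ - 2) / (2 + δ)) 1 + (2 - γ) / (2 * δ)) - γ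

lemma mp_second {ψ : V3 → ℝ} (hψ : ContDiff ℝ 2 ψ) (v0 : V3) (hmax : ∀ v, ψ v ≤ ψ v0) (e : V3) :
    fderiv ℝ (fderiv ℝ ψ) v0 e e ≤ 0 := by
  have h1 : Differentiable ℝ ψ := hψ.differentiable (by norm_num)
  have h2 : Differentiable ℝ (fderiv ℝ ψ) :=
    (hψ.fderiv_right (m := 1) (by norm_num)).differentiable (by norm_num)
  have hl : ∀ s : ℝ, HasDerivAt (fun s : ℝ => v0 + s • e) e s := by
    intro s
    simpa using ((hasDerivAt_id s).smul_const e).const_add v0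
  set f : ℝ → ℝ := fun s => ψ (v0 + s • e) with hf
  have hd : ∀ s, HasDerivAt f (fderiv ℝ ψ (v0 + s • e) e) s := fun s =>
    (h1 _).hasFDerivAt.comp_hasDerivAt s (hl s)
  have hdf : deriv f = fun s => fderiv ℝ ψ (v0 + s • e) e := funext fun s => (hd s).deriv
  have hdd : deriv (deriv f) 0 = fderiv ℝ (fderiv ℝ ψ) v0 e e := by
    rw [hdf]
    have h3 : HasDerivAt (fun s : ℝ => fderiv ℝ ψ (v0 + s • e)) (fderiv ℝ (fderiv ℝ ψ) (v0 + (0:ℝ) • e) e) 0 :=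
      (h2 _).hasFDerivAt.comp_hasDerivAt (0:ℝ) (hl 0)
    have := (h3.clm_apply (hasDerivAt_const (0:ℝ) e)).deriv
    simpa using this
  have hmx : IsLocalMax f 0 := by
    refine Filter.Eventually.of_forall fun s => ?_
    simpa [hf] using hmax (v0 + s • e)
  by_contra hcon
  push Not at hcon
  rw [← hdd] at hcon
  have hmin := isLocalMin_of_deriv_deriv_pos hcon hmx.deriv_eq_zero (hd 0).continuousAt
  have hc : f =ᶠ[nhds 0] fun _ => f 0 := by
    filter_upwards [hmin, hmx] with s a b
    exact le_antisymm b a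
  have h4 := hc.deriv.deriv_eq
  simp at h4
  linarith

lemma mp_expand (L : V3 →L[ℝ] V3 →L[ℝ] ℝ) (e : V3) :
    ∑ i, ∑ j, L (esingle i) (esingle j) * e i * e j = L e e := by
  have he : e = ∑ i, e i • esingle i := by
    ext k
    simp [esingle, Fin.sum_univ_three]
    fin_cases k <;> simp
  conv_rhs => rw [he]
  simp only [map_sum, map_smul, _root_.sum_apply, _root_.smul_apply, smul_eq_mul,
    Finset.mul_sum]
  rw [Finset.sum_comm]
  refine Finset.sum_congr rfl fun i _ => Finset.sum_congr rfl fun j _ => ?_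
  ring

lemma mp_hess_neg {ψ : V3 → ℝ} (hψ : ContDiff ℝ 2 ψ) (v0 : V3) (hmax : ∀ v, ψ v ≤ ψ v0) (e : V3) :
    quadForm (hess ψ v0) e ≤ 0 := by
  have := mp_second hψ v0 hmax e
  rw [← mp_expand] at this
  simpa [quadForm, bilin, hess, iteratedFDeriv_two_apply] using this

lemma mp_proj_aux (x : Fin 3 → ℝ) (h : (x 0)^2 + (x 1)^2 + (x 2)^2 = 1) (i j : Fin 3) :
    (if i = j then (1:ℝ) else 0) - x i * x j = ∑ k, ((if i = k then (1:ℝ) else 0) - x i * x k) *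
      ((if j = k then (1:ℝ) else 0) - x j * x k) := by
  have : ∀ a b : ℝ, a * b * ((x 0)^2 + (x 1)^2 + (x 2)^2) = a * b := by intro a b; rw [h, mul_one]
  have h2 := this (x i) (x j)
  rw [Fin.sum_univ_three]
  fin_cases i <;> fin_cases j <;> simp at h2 ⊢ <;> linarith

lemma mp_proj_sq (z : V3) (i j : Fin 3) : proj z i j = ∑ k, proj z i k * proj z j k := by
  by_cases hz : z = 0
  · subst hz
    fin_cases i <;> fin_cases j <;> simp [proj, Fin.sum_univ_three]
  · have hn : ‖z‖ ≠ 0 := norm_ne_zero_iff.2 hz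
    have h : (z 0 / ‖z‖)^2 + (z 1 / ‖z‖)^2 + (z 2 / ‖z‖)^2 = 1 := by
      have := EuclideanSpace.norm_sq_eq z
      simp [Fin.sum_univ_three] at this
      field_simp
      linarith
    exact mp_proj_aux (fun i => z i / ‖z‖) h i j

lemma mp_proj_dot (z : V3) (H : Mat3) (hH : ∀ e, quadForm H e ≤ 0) : matDot (proj z) H ≤ 0 := by
  have : matDot (proj z) H = ∑ k, quadForm H (WithLp.toLp 2 fun i => proj z i k) := by
    simp only [matDot, quadForm, bilin]
    conv_lhs => enter [2, i, 2, j]; rw [mp_proj_sq]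
    simp only [Fin.sum_univ_three]
    ring
  rw [this]
  exact Finset.sum_nonpos fun k _ => hH _

lemma mp_proj_abs (z : V3) (i j : Fin 3) : |proj z i j| ≤ 2 := by
  have h : ∀ i, |z i / ‖z‖| ≤ 1 := by
    intro i
    rw [abs_div, abs_norm]
    exact div_le_one_of_le₀ (PiLp.norm_apply_le z i) (norm_nonneg _)
  have h2 : |z i / ‖z‖ * (z j / ‖z‖)| ≤ 1 := by
    rw [abs_mul]; exact mul_le_one₀ (h i) (abs_nonneg _) (h j)
  unfold proj
  have h3 := abs_le.1 h2
  split_ifs <;> rw [abs_le] <;> constructor <;> linarith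

lemma mp_int_ball {α : ℝ} (h : -3 < α) :
    Integrable (Set.indicator (Metric.ball (0:V3) 1) fun z => ‖z‖ ^ α) := by
  rw [integrable_indicator_iff Metric.isOpen_ball.measurableSet]
  rw [integrableOn_fun_norm_addHaar volume (f := fun x => x ^ α)]
  have h1 : IntegrableOn (fun x : ℝ => x ^ (α + 2)) (Set.Ioo 0 1) :=
    (intervalIntegral.integrableOn_Ioo_rpow_iff zero_lt_one).2 (by linarith)
  refine h1.congr_fun (fun x hx => ?_) measurableSet_Ioo
  simp only [finrank_euclideanSpace, Fintype.card_fin, smul_eq_mul]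
  rw [Real.rpow_add hx.1, mul_comm]
  norm_num

lemma mp_conv {α B : ℝ} (h : -3 < α) (h0 : α ≤ 0) :
    ∃ C : ℝ, 0 ≤ C ∧ ∀ f : V3 → ℝ, Measurable f → (∀ v, 0 ≤ f v) → Integrable f → (∫ v, f v) = 1 →
      (∀ v, f v ≤ B) → ∀ v, Integrable (fun w => ‖v - w‖ ^ α * f w) ∧
        (∫ w, ‖v - w‖ ^ α * f w) ≤ C := by
  set I := Set.indicator (Metric.ball (0:V3) 1) fun z => ‖z‖ ^ α with hI
  have hInn : ∀ z, 0 ≤ I z := fun z => Set.indicator_nonneg (fun z _ => by positivity) z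
  refine ⟨|B| * (∫ z, I z) + 1, add_nonneg (mul_nonneg (abs_nonneg _) (integral_nonneg hInn)) zero_le_one, ?_⟩
  intro f hm hn hi hmass hB v
  have hIi : Integrable fun w => I (v - w) := (mp_int_ball h).comp_sub_left v
  have hdom : ∀ w, ‖v - w‖ ^ α * f w ≤ |B| * I (v - w) + f w := by
    intro w
    by_cases hw : v - w ∈ Metric.ball (0:V3) 1
    · have : I (v - w) = ‖v - w‖ ^ α := Set.indicator_of_mem hw _
      rw [this, mul_comm]
      have h1 : f w ≤ |B| := (hB w).trans (le_abs_self B)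
      have h2 : 0 ≤ ‖v - w‖ ^ α := by positivity
      nlinarith [hn w, mul_le_mul_of_nonneg_right h1 h2]
    · have h1 : 1 ≤ ‖v - w‖ := by simpa using hw
      have h2 : ‖v - w‖ ^ α ≤ 1 := Real.rpow_le_one_of_one_le_of_nonpos h1 h0
      have h3 : 0 ≤ |B| * I (v - w) := mul_nonneg (abs_nonneg _) (hInn _)
      nlinarith [hn w, mul_le_mul_of_nonneg_right h2 (hn w)]
  have hdi : Integrable fun w => |B| * I (v - w) + f w := (hIi.const_mul _).add hi
  have hnn : ∀ w, 0 ≤ ‖v - w‖ ^ α * f w := fun w => mul_nonneg (by positivity) (hn w)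
  constructor
  · refine hdi.mono' ?_ (Filter.Eventually.of_forall fun w => ?_)
    · exact (Measurable.mul (by fun_prop) hm).aestronglyMeasurable
    · rw [Real.norm_of_nonneg (hnn w)]; exact hdom w
  · refine (integral_mono_of_nonneg (Filter.Eventually.of_forall hnn) hdi (Filter.Eventually.of_forall hdom)).trans ?_
    rw [integral_add (hIi.const_mul _) hi, hmass, integral_const_mul, integral_sub_left_eq_self]

/-- barrier -/
def mpBar (l : ℝ) (v : V3) : ℝ := Real.exp (l * (1 + ‖v‖ ^ 2))

lemma mpBar_contDiff (l : ℝ) : ContDiff ℝ 2 (mpBar l) := by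
  unfold mpBar
  exact ((contDiff_const.add (contDiff_norm_sq ℝ)).const_smul l).exp

lemma mpBar_fderiv (l : ℝ) (v : V3) :
    HasFDerivAt (mpBar l) (mpBar l v • (l • (2 • innerSL ℝ v))) v := by
  have h := (((hasStrictFDerivAt_norm_sq v).hasFDerivAt.const_add 1).const_mul l).exp
  exact h

lemma mpBar_hess (l : ℝ) (v : V3) (i j : Fin 3) :
    hess (mpBar l) v i j = mpBar l v * (4 * l ^ 2 * (v i * v j) + 2 * l * (if i = j then 1 else 0)) := by
  have h2 : Differentiable ℝ (fderiv ℝ (mpBar l)) :=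
    ((mpBar_contDiff l).fderiv_right (m := 1) (by norm_num)).differentiable (by norm_num)
  have hin : ∀ (w : V3) (k : Fin 3), inner ℝ w (esingle k) = w k := by
    intro w k
    simp [esingle, EuclideanSpace.inner_single_right]
  have e1 : (fun w => fderiv ℝ (mpBar l) w (esingle j)) = fun w => mpBar l w * (2 * l * w j) := by
    funext w
    rw [(mpBar_fderiv l w).fderiv]
    simp only [_root_.smul_apply, innerSL_apply_apply, hin, smul_eq_mul, nsmul_eq_mul]
    push_cast
    ring
  have e2 : HasFDerivAt (fun w => fderiv ℝ (mpBar l) w (esingle j))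
      ((fderiv ℝ (fderiv ℝ (mpBar l)) v).flip (esingle j)) v := by
    have := (h2 v).hasFDerivAt.clm_apply (hasFDerivAt_const (esingle j) v)
    simpa using this
  have hp : HasFDerivAt (fun w : V3 => 2 * l * w j) ((2 * l) • (EuclideanSpace.proj j : V3 →L[ℝ] ℝ)) v :=
    (EuclideanSpace.proj j : V3 →L[ℝ] ℝ).hasFDerivAt.const_mul (2 * l)
  have e3 := (mpBar_fderiv l v).mul hp
  rw [e1] at e2
  have e4 := congrArg (fun L : V3 →L[ℝ] ℝ => L (esingle i)) (e2.unique e3)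
  simp only [hess, iteratedFDeriv_two_apply]
  simp [hin] at e4
  simp only [Matrix.cons_val_zero, Matrix.cons_val_one]
  rw [e4]
  have : (esingle i).ofLp j = if i = j then (1:ℝ) else 0 := by
    simp [esingle, Pi.single_apply, eq_comm]
  rw [this]
  ring

lemma mpBar_dot (l Λ : ℝ) (hl : 0 ≤ l) (hΛ : 0 ≤ Λ) (A : Mat3) (hA : ∀ i j, |A i j| ≤ Λ) (v : V3) :
    matDot A (hess (mpBar l) v) ≤ 36 * Λ * (l + l ^ 2) * (1 + ‖v‖ ^ 2) * mpBar l v := by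
  have hφ : 0 < mpBar l v := Real.exp_pos _
  have hent : ∀ i j, A i j * hess (mpBar l) v i j ≤ Λ * (mpBar l v * (4 * l ^ 2 * ‖v‖^2 + 2 * l)) := by
    intro i j
    refine (le_abs_self _).trans ?_
    rw [abs_mul]
    refine mul_le_mul (hA i j) ?_ (abs_nonneg _) hΛ
    rw [mpBar_hess, abs_mul, abs_of_pos hφ]
    refine mul_le_mul_of_nonneg_left ?_ hφ.le
    have h1 : |v i * v j| ≤ ‖v‖ ^ 2 := by
      rw [abs_mul, sq]
      exact mul_le_mul (PiLp.norm_apply_le v i) (PiLp.norm_apply_le v j) (abs_nonneg _) (norm_nonneg _)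
    refine (abs_add_le _ _).trans (add_le_add ?_ ?_)
    · rw [abs_mul, abs_of_nonneg (by positivity)]
      exact mul_le_mul_of_nonneg_left h1 (by positivity)
    · split_ifs
      · rw [mul_one, abs_of_nonneg (by positivity)]
      · simp; exact hl
  have : matDot A (hess (mpBar l) v) ≤ ∑ i : Fin 3, ∑ j : Fin 3, Λ * (mpBar l v * (4 * l ^ 2 * ‖v‖^2 + 2 * l)) :=
    Finset.sum_le_sum fun i _ => Finset.sum_le_sum fun j _ => hent i j
  refine this.trans ?_
  simp only [Finset.sum_const, Finset.card_univ, Fintype.card_fin, nsmul_eq_mul]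
  have h0 : 0 ≤ Λ * mpBar l v := by positivity
  have h1 : 4 * l ^ 2 * ‖v‖^2 + 2 * l ≤ 4 * (l + l^2) * (1 + ‖v‖^2) := by
    nlinarith [mul_nonneg hl (sq_nonneg ‖v‖), sq_nonneg l]
  have := mul_le_mul_of_nonneg_left h1 h0
  push_cast
  linarith

lemma mp_deriv_nonneg {f : ℝ → ℝ} {f' a t : ℝ} (hat : a < t) (hd : HasDerivWithinAt f f' (Set.Ioo a t) t)
    (h : ∀ s ∈ Set.Ioo a t, f s ≤ f t) : 0 ≤ f' := by
  have := right_nhdsWithin_Ioo_neBot hat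
  refine ge_of_tendsto ((hasDerivWithinAt_iff_tendsto_slope' (by simp)).1 hd) ?_
  filter_upwards [self_mem_nhdsWithin] with s hs
  rw [slope_def_field]
  exact div_nonneg_of_nonpos (by linarith [h s hs]) (by linarith [hs.2])

set_option maxHeartbeats 1000000 in
lemma mp_core (T : ℝ) (A : ℝ → V3 → Mat3) (c : ℝ → V3 → ℝ) (Λ L K η : ℝ) (hΛ : 0 ≤ Λ) (hL : 0 ≤ L)
    (hK : 0 < K) (hη : 0 < η)
    (hA : ∀ t ∈ Set.Ioc (0 : ℝ) T, ∀ v i j, |A t v i j| ≤ Λ)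
    (hApsd : ∀ t ∈ Set.Ioc (0 : ℝ) T, ∀ v H, (∀ e, quadForm H e ≤ 0) → matDot (A t v) H ≤ 0)
    (hc : ∀ t ∈ Set.Ioc (0 : ℝ) T, ∀ v, c t v ≤ L)
    (u : ℝ → V3 → ℝ)
    (hucont : ContinuousOn (fun q : ℝ × V3 => u q.1 q.2) (Set.Icc (0 : ℝ) T ×ˢ Set.univ))
    (hutime : ∀ v, ContDiffOn ℝ 1 (fun t => u t v) (Set.Ioc (0 : ℝ) T))
    (huvel : ∀ t ∈ Set.Ioc (0 : ℝ) T, ContDiff ℝ 2 (u t))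
    (hsub : ∀ t ∈ Set.Ioc (0 : ℝ) T, ∀ v,
      derivWithin (fun s => u s v) (Set.Ioc (0 : ℝ) T) t ≤
        matDot (A t v) (hess (u t) v) + c t v * u t v)
    (hgrowth : ∀ t ∈ Set.Icc (0 : ℝ) T, ∀ v : V3, u t v ≤ K * Real.exp (η * ‖v‖ ^ 2))
    (κ : ℝ) (hκ0 : 0 < κ) (hκ : 36 * Λ * ((η + 2) + (η + 2) ^ 2) < κ)
    (a : ℝ) (ha : 0 ≤ a) (hinit : ∀ v : V3, u a v ≤ 0)
    (t1 : ℝ) (ht1 : t1 ∈ Set.Icc a (a + 1 / κ)) (ht1T : t1 ≤ T) (v1 : V3) : u t1 v1 ≤ 0 := by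
  by_contra hcon
  push Not at hcon
  set lam : ℝ → ℝ := fun t => η + 1 + κ * (t - a) with hlam
  set ε : ℝ := Real.exp (-L * t1) * u t1 v1 / (2 * mpBar (lam t1) v1) with hε
  have hφ : ∀ l v, 0 < mpBar l v := fun l v => Real.exp_pos _
  have hεpos : 0 < ε := div_pos (mul_pos (Real.exp_pos _) hcon) (by linarith [hφ (lam t1) v1])
  set M : ℝ × V3 → ℝ := fun q => Real.exp (-L * q.1) * u q.1 q.2 - ε * mpBar (lam q.1) q.2 with hM
  have hM1 : 0 < M (t1, v1) := by
    have : ε * mpBar (lam t1) v1 = Real.exp (-L * t1) * u t1 v1 / 2 := by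
      rw [hε]; field_simp [(hφ (lam t1) v1).ne']
    simp only [hM, this]
    have := mul_pos (Real.exp_pos (-L * t1)) hcon
    linarith
  have hsubI : Set.Icc a t1 ⊆ Set.Icc 0 T := Set.Icc_subset_Icc ha ht1T
  have hlamt : ∀ t ∈ Set.Icc a t1, η + 1 ≤ lam t ∧ lam t ≤ η + 2 := by
    intro t ht
    have h1 : 0 ≤ κ * (t - a) := mul_nonneg hκ0.le (by linarith [ht.1])
    have h2 : κ * (t - a) ≤ κ * (1 / κ) := mul_le_mul_of_nonneg_left (by linarith [ht.2, ht1.2]) hκ0.le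
    rw [mul_one_div_cancel hκ0.ne'] at h2
    simp only [hlam]
    constructor <;> linarith
  set R : ℝ := max ‖v1‖ (K / ε + 1) with hR
  have hR1 : 1 ≤ R := le_max_of_le_right (by have := div_pos hK hεpos; linarith)
  have hfar : ∀ t ∈ Set.Icc a t1, ∀ v : V3, R < ‖v‖ → M (t, v) ≤ 0 := by
    intro t ht v hv
    have h1 : Real.exp (-L * t) * u t v ≤ K * Real.exp (η * ‖v‖ ^ 2) := by
      have g1 : Real.exp (-L * t) ≤ 1 := Real.exp_le_one_iff.2 (by nlinarith [mul_nonneg hL (ha.trans ht.1)])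
      have g2 := hgrowth t (hsubI ht) v
      have g3 : 0 < K * Real.exp (η * ‖v‖ ^ 2) := mul_pos hK (Real.exp_pos _)
      calc _ ≤ Real.exp (-L * t) * (K * Real.exp (η * ‖v‖ ^ 2)) :=
            mul_le_mul_of_nonneg_left g2 (Real.exp_pos _).le
        _ ≤ 1 * (K * Real.exp (η * ‖v‖ ^ 2)) := mul_le_mul_of_nonneg_right g1 g3.le
        _ = _ := one_mul _
    have h2 : Real.exp (η * ‖v‖ ^ 2) * Real.exp (‖v‖ ^ 2) ≤ mpBar (lam t) v := by
      rw [← Real.exp_add]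
      unfold mpBar
      refine Real.exp_le_exp.2 ?_
      nlinarith [mul_le_mul_of_nonneg_right (hlamt t ht).1 (by positivity : 0 ≤ 1 + ‖v‖^2)]
    have h3 : K ≤ ε * Real.exp (‖v‖ ^ 2) := by
      have g1 : K / ε ≤ ‖v‖ := by linarith [le_max_right ‖v1‖ (K / ε + 1)]
      have g2 : ‖v‖ ≤ ‖v‖ ^ 2 := by nlinarith
      have g3 := Real.add_one_le_exp (‖v‖ ^ 2)
      have g4 : K / ε ≤ Real.exp (‖v‖ ^ 2) := by linarith
      rw [div_le_iff₀ hεpos] at g4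
      linarith
    have h4 := mul_le_mul_of_nonneg_right h3 (Real.exp_pos (η * ‖v‖ ^ 2)).le
    have h5 := mul_le_mul_of_nonneg_left h2 hεpos.le
    simp only [hM]
    nlinarith
  have hcomp : IsCompact (Set.Icc a t1 ×ˢ Metric.closedBall (0:V3) R) :=
    isCompact_Icc.prod (isCompact_closedBall _ _)
  have hmem1 : (t1, v1) ∈ Set.Icc a t1 ×ˢ Metric.closedBall (0:V3) R :=
    ⟨⟨ht1.1, le_rfl⟩, by simp [hR]⟩
  have hMc : ContinuousOn M (Set.Icc a t1 ×ˢ Metric.closedBall (0:V3) R) := by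
    refine ContinuousOn.sub (ContinuousOn.mul (by fun_prop) (hucont.mono ?_)) ?_
    · exact Set.prod_mono hsubI (Set.subset_univ _)
    · unfold mpBar
      simp only [hlam]
      fun_prop
  obtain ⟨⟨t0, v0⟩, hmem0, hmax0⟩ := hcomp.exists_isMaxOn ⟨_, hmem1⟩ hMc
  have hM0 : 0 < M (t0, v0) := hM1.trans_le (hmax0 hmem1)
  have ht0 : t0 ∈ Set.Icc a t1 := hmem0.1
  have hmax : ∀ t ∈ Set.Icc a t1, ∀ v, M (t, v) ≤ M (t0, v0) := by
    intro t ht v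
    by_cases hv : ‖v‖ ≤ R
    · have hm : (t, v) ∈ Set.Icc a t1 ×ˢ Metric.closedBall (0:V3) R := ⟨ht, by simpa using hv⟩
      exact hmax0 hm
    · exact (hfar t ht v (not_le.1 hv)).trans hM0.le
  have hupos : 0 < u t0 v0 := by
    have h1 : 0 < ε * mpBar (lam t0) v0 := mul_pos hεpos (hφ _ _)
    have h2 : 0 < Real.exp (-L * t0) * u t0 v0 := by simp only [hM] at hM0; linarith
    exact (mul_pos_iff_of_pos_left (Real.exp_pos _)).1 h2
  have hat0 : a < t0 := by
    refine lt_of_le_of_ne ht0.1 fun h => ?_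
    rw [← h] at hupos
    linarith [hinit v0]
  have ht0' : t0 ∈ Set.Ioc 0 T := ⟨ha.trans_lt hat0, ht0.2.trans ht1T⟩
  -- time derivative
  set u' := derivWithin (fun s => u s v0) (Set.Ioc (0 : ℝ) T) t0 with hu'
  have hdu : HasDerivWithinAt (fun s => u s v0) u' (Set.Ioc 0 T) t0 :=
    ((hutime v0).differentiableOn (by norm_num) t0 ht0').hasDerivWithinAt
  have hdu2 : HasDerivWithinAt (fun s => u s v0) u' (Set.Ioo a t0) t0 :=
    hdu.mono fun s hs => ⟨ha.trans_lt hs.1, hs.2.le.trans ht0'.2⟩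
  have hde : HasDerivAt (fun s => Real.exp (-L * s)) (Real.exp (-L * t0) * (-L)) t0 := by
    simpa using ((hasDerivAt_id t0).const_mul (-L)).exp
  have hdb : HasDerivAt (fun s => mpBar (lam s) v0) (mpBar (lam t0) v0 * (κ * (1 + ‖v0‖^2))) t0 := by
    have h1 : HasDerivAt lam κ t0 := by
      simpa [hlam] using (((hasDerivAt_id t0).sub_const a).const_mul κ).const_add (η + 1)
    exact (h1.mul_const (1 + ‖v0‖^2)).exp
  have htd := mp_deriv_nonneg hat0
    ((hde.hasDerivWithinAt.mul hdu2).sub (hdb.hasDerivWithinAt.const_mul ε))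
    (fun s hs => hmax s ⟨hs.1.le, hs.2.le.trans ht0.2⟩ v0)
  -- space
  have hu2 := huvel t0 ht0'
  have hψ : ContDiff ℝ 2 (fun v => Real.exp (-L * t0) * u t0 v - ε * mpBar (lam t0) v) :=
    (contDiff_const.mul hu2).sub (contDiff_const.mul (mpBar_contDiff _))
  have hq := hApsd t0 ht0' v0 _ (mp_hess_neg hψ v0 (fun v => hmax t0 ht0 v))
  have hhess : hess (fun v => Real.exp (-L * t0) * u t0 v - ε * mpBar (lam t0) v) v0 =
      fun i j => Real.exp (-L * t0) * hess (u t0) v0 i j - ε * hess (mpBar (lam t0)) v0 i j := by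
    funext i j
    have e : (fun v => Real.exp (-L * t0) * u t0 v - ε * mpBar (lam t0) v) =
      (Real.exp (-L * t0) • u t0) - (ε • mpBar (lam t0)) := rfl
    unfold hess
    have c1 : ContDiffAt ℝ ((2:ℕ):WithTop ℕ∞) (Real.exp (-L * t0) • u t0) v0 := (hu2.const_smul (Real.exp (-L * t0))).contDiffAt
    have c2 : ContDiffAt ℝ ((2:ℕ):WithTop ℕ∞) (ε • mpBar (lam t0)) v0 := ((mpBar_contDiff (lam t0)).const_smul ε).contDiffAt
    rw [e, iteratedFDeriv_sub_apply c1 c2,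
      iteratedFDeriv_const_smul_apply hu2.contDiffAt, iteratedFDeriv_const_smul_apply (mpBar_contDiff _).contDiffAt]
    simp
  have hlin : matDot (A t0 v0) (fun i j => Real.exp (-L * t0) * hess (u t0) v0 i j - ε * hess (mpBar (lam t0)) v0 i j)
      = Real.exp (-L * t0) * matDot (A t0 v0) (hess (u t0) v0) - ε * matDot (A t0 v0) (hess (mpBar (lam t0)) v0) := by
    simp only [matDot, Fin.sum_univ_three]; ring
  rw [hhess, hlin] at hq
  have hl := hlamt t0 ht0
  have hd := mpBar_dot (lam t0) Λ (by linarith) hΛ _ (hA t0 ht0' v0) v0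
  have hs := hsub t0 ht0' v0
  have hcu : c t0 v0 * u t0 v0 ≤ L * u t0 v0 := mul_le_mul_of_nonneg_right (hc t0 ht0' v0) hupos.le
  have hmul := mul_le_mul_of_nonneg_left (hs.trans (add_le_add_right hcu _)) (Real.exp_pos (-L * t0)).le
  have hd2 := mul_le_mul_of_nonneg_left hd hεpos.le
  have hb := hφ (lam t0) v0
  have hkk : 36 * Λ * (lam t0 + lam t0 ^ 2) < κ := by
    refine lt_of_le_of_lt ?_ hκ
    refine mul_le_mul_of_nonneg_left ?_ (by positivity)
    nlinarith [hl.1, hl.2]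
  have hpos : 0 < (1 + ‖v0‖ ^ 2) * mpBar (lam t0) v0 * ε := by positivity
  have hfin := mul_lt_mul_of_pos_right hkk hpos
  rw [← hu'] at hmul
  linarith

lemma mp_iter {T τ : ℝ} (hτ : 0 < τ) (P : ℝ → Prop) (h0 : P 0)
    (hstep : ∀ a, 0 ≤ a → P a → ∀ t ∈ Set.Icc a (a + τ), t ≤ T → P t) :
    ∀ t ∈ Set.Icc 0 T, P t := by
  have h : ∀ n : ℕ, ∀ t, 0 ≤ t → t ≤ T → t ≤ n * τ → P t := by
    intro n
    induction n with
    | zero =>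
      intro t h1 _ h2
      have : t = 0 := le_antisymm (by simpa using h2) h1
      rw [this]; exact h0
    | succ n ih =>
      intro t h1 h2 h3
      push_cast at h3
      by_cases hle : t ≤ n * τ
      · exact ih t h1 h2 hle
      · push Not at hle
        have hn : 0 ≤ (n:ℝ) * τ := by positivity
        exact hstep (n * τ) hn (ih _ hn (by linarith) le_rfl) t ⟨hle.le, by linarith⟩ h2
  intro t ht
  obtain ⟨n, hn⟩ := exists_nat_ge (t / τ)
  exact h n t ht.1 ht.2 ((div_le_iff₀ hτ).1 hn)

lemma mp_kernel_int {γ : ℝ} {f : V3 → ℝ} (hm : Measurable f) (hn : ∀ v, 0 ≤ f v) (v : V3)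
    (hi : Integrable (fun w => ‖v - w‖ ^ (γ + 2) * f w)) (i j : Fin 3) :
    Integrable (fun w => landauKernel γ (v - w) i j * f w) ∧
    |abar γ f v i j| ≤ 2 * ∫ w, ‖v - w‖ ^ (γ + 2) * f w := by
  have hb : ∀ w, ‖landauKernel γ (v - w) i j * f w‖ ≤ 2 * (‖v - w‖ ^ (γ + 2) * f w) := by
    intro w
    have h1 : 0 ≤ ‖v - w‖ ^ (γ + 2) := by positivity
    rw [Real.norm_eq_abs, landauKernel, abs_mul, abs_mul, abs_of_nonneg h1, abs_of_nonneg (hn w)]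
    have := mul_le_mul_of_nonneg_left (mp_proj_abs (v - w) i j) (mul_nonneg h1 (hn w))
    linarith
  constructor
  · refine (hi.const_mul 2).mono' ?_ (Filter.Eventually.of_forall hb)
    refine (Measurable.mul ?_ hm).aestronglyMeasurable
    unfold landauKernel proj
    have : ∀ k : Fin 3, Measurable fun w : V3 => (v - w) k := fun k => by
      have : Continuous fun w : V3 => (v - w) k := by fun_prop
      exact this.measurable
    have hi := this i
    have hj := this j
    have hnm : Measurable fun w : V3 => ‖v - w‖ := by fun_prop
    exact (hnm.pow_const _).mul (measurable_const.sub ((hi.div hnm).mul (hj.div hnm)))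
  · rw [← integral_const_mul]
    exact norm_integral_le_of_norm_le (hi.const_mul 2) (Filter.Eventually.of_forall hb)

lemma mp_abar_psd {γ : ℝ} {f : V3 → ℝ} (hm : Measurable f) (hn : ∀ v, 0 ≤ f v) (v : V3)
    (hi : Integrable (fun w => ‖v - w‖ ^ (γ + 2) * f w)) (H : Mat3) (hH : ∀ e, quadForm H e ≤ 0) :
    matDot (abar γ f v) H ≤ 0 := by
  have e : matDot (abar γ f v) H =
      ∫ w, ∑ i, ∑ j, landauKernel γ (v - w) i j * f w * H i j := by
    rw [integral_finsetSum]
    · refine Finset.sum_congr rfl fun i _ => ?_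
      rw [integral_finsetSum]
      · refine Finset.sum_congr rfl fun j _ => ?_
        rw [integral_mul_const]; rfl
      · intro j _
        exact (mp_kernel_int hm hn v hi i j).1.mul_const _
    · intro i _
      exact integrable_finsetSum _ fun j _ => (mp_kernel_int hm hn v hi i j).1.mul_const _
  rw [e]
  refine integral_nonpos fun w => ?_
  have : ∑ i, ∑ j, landauKernel γ (v - w) i j * f w * H i j =
      (‖v - w‖ ^ (γ + 2) * f w) * matDot (proj (v - w)) H := by
    simp only [landauKernel, matDot, Fin.sum_univ_three]; ring
  show ∑ i, ∑ j, landauKernel γ (v - w) i j * f w * H i j ≤ 0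
  rw [this]
  exact mul_nonpos_of_nonneg_of_nonpos (mul_nonneg (by positivity) (hn w)) (mp_proj_dot _ H hH)

/-- maximum principle for the Landau coefficients
(Proposition 2 / Appendix A of the paper). -/
theorem maximum_principle_landau
    (γ : ℝ) (hγ : γ ∈ Set.Icc (-3 : ℝ) (-2)) (T : ℝ) (hT : 0 < T)
    (g : ℝ → V3 → ℝ)
    (hgmeas : ∀ t ∈ Set.Icc (0 : ℝ) T, Measurable (g t))
    (hgnonneg : ∀ t ∈ Set.Icc (0 : ℝ) T, ∀ v, 0 ≤ g t v)
    (hgint : ∀ t ∈ Set.Icc (0 : ℝ) T, Integrable (g t))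
    (hgmass : ∀ t ∈ Set.Icc (0 : ℝ) T, (∫ v, g t v) = 1)
    (hgbdd : ∃ B : ℝ, ∀ t ∈ Set.Icc (0 : ℝ) T, ∀ v, g t v ≤ B)
    (hgmom : ∃ Mp : ℝ, ∀ t ∈ Set.Icc (0 : ℝ) T,
      Integrable (fun v => jap v ^ (γ * (γ + 2) / (γ + 5) - γ) * g t v) ∧
      (∫ v, jap v ^ (γ * (γ + 2) / (γ + 5) - γ) * g t v) ≤ Mp)
    (u : ℝ → V3 → ℝ)
    (hucont : ContinuousOn (fun q : ℝ × V3 => u q.1 q.2) (Set.Icc (0 : ℝ) T ×ˢ Set.univ))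
    (hutime : ∀ v, ContDiffOn ℝ 1 (fun t => u t v) (Set.Ioc (0 : ℝ) T))
    (huvel : ∀ t ∈ Set.Ioc (0 : ℝ) T, ContDiff ℝ 2 (u t))
    -- u is a subsolution on (0,T] × ℝ³
    (hsub : ∀ t ∈ Set.Ioc (0 : ℝ) T, ∀ v,
      derivWithin (fun s => u s v) (Set.Ioc (0 : ℝ) T) t ≤
        matDot (abar γ (g t) v) (hess (u t) v) + cbar γ (g t) v * u t v)
    (hinit : ∀ v : V3, u 0 v ≤ 0)
    -- growth condition
    (hgrowth : ∃ K η : ℝ, 0 < K ∧ 0 < η ∧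
      ∀ t ∈ Set.Icc (0 : ℝ) T, ∀ v : V3, u t v ≤ K * Real.exp (η * ‖v‖ ^ 2)) :
    ∀ t ∈ Set.Icc (0 : ℝ) T, ∀ v : V3, u t v ≤ 0 := by
  obtain ⟨B, hB⟩ := hgbdd
  obtain ⟨K, η, hK, hη, hgr⟩ := hgrowth
  obtain ⟨C1, hC1, hconv⟩ := mp_conv (α := γ + 2) (B := B) (by linarith [hγ.1]) (by linarith [hγ.2])
  have hIoc : Set.Ioc (0:ℝ) T ⊆ Set.Icc 0 T := Set.Ioc_subset_Icc_self
  obtain ⟨L, hL, hcL⟩ : ∃ L : ℝ, 0 ≤ L ∧ ∀ t ∈ Set.Icc (0:ℝ) T, ∀ v, cbar γ (g t) v ≤ L := by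
    by_cases h3 : γ = -3
    · refine ⟨8 * Real.pi * |B|, by positivity, fun t ht v => ?_⟩
      rw [cbar, if_pos h3]
      exact mul_le_mul_of_nonneg_left ((hB t ht v).trans (le_abs_self B)) (by positivity)
    · have hlt : -3 < γ := lt_of_le_of_ne hγ.1 (Ne.symm h3)
      obtain ⟨C2, hC2, hconv2⟩ := mp_conv (α := γ) (B := B) hlt (by linarith [hγ.2])
      refine ⟨2 * (γ + 3) * C2, mul_nonneg (by linarith) hC2, fun t ht v => ?_⟩
      rw [cbar, if_neg h3]
      exact mul_le_mul_of_nonneg_left (hconv2 (g t) (hgmeas t ht) (hgnonneg t ht) (hgint t ht)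
        (hgmass t ht) (hB t ht) v).2 (by linarith)
  have hcv := fun t ht => hconv (g t) (hgmeas t ht) (hgnonneg t ht) (hgint t ht) (hgmass t ht) (hB t ht)
  set κ : ℝ := 36 * (2 * C1) * ((η + 2) + (η + 2) ^ 2) + 1 with hκ
  have hκ0 : 0 < κ := by positivity
  refine mp_iter (T := T) (τ := 1 / κ) (by positivity) (fun t => ∀ v, u t v ≤ 0) hinit ?_
  intro a ha hua t ht htT v
  refine mp_core T (fun t v => abar γ (g t) v) (fun t v => cbar γ (g t) v) (2 * C1) L K η (by linarith) hL hK hη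
    ?_ ?_ (fun t ht v => hcL t (hIoc ht) v) u hucont hutime huvel hsub hgr κ hκ0 (by linarith) a ha hua t ht htT v
  · intro t ht v i j
    have ht' := hIoc ht
    refine (mp_kernel_int (hgmeas t ht') (hgnonneg t ht') v (hcv t ht' v).1 i j).2.trans ?_
    linarith [(hcv t ht' v).2]
  · intro t ht v H hH
    have ht' := hIoc ht
    exact mp_abar_psd (hgmeas t ht') (hgnonneg t ht') v (hcv t ht' v).1 H hH

end
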